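/- Let θ ∈ (0,1) and k > 1. There exists δ₀ > 0 such that for all δ ∈ (0, δ₀): if a ∈ C²([0,∞)×ℝ) satisfies |∂_t^α ∂_x^β a(t,x)| ≤ δ/(1+t)^{k+α} for α, β ∈ {0,1}, then there exists a classical solution h ∈ C²([0,∞)×ℝ) of h_{tt} − h_{xx} − a·h_t − a_t·(1+h) = 0 satisfying |h(t,x)| ≤ θ·(1+t)^{−(k−1)} and |∂_t^α ∂_x^β h(t,x)| ≤ C·(1+t)^{−k} for α+β = 1, for some constant C > 0. -/

import Mathlib

/-- Partial derivative in the first (time) variable. -/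
noncomputable def pt (f : ℝ → ℝ → ℝ) : ℝ → ℝ → ℝ := fun t x => deriv (fun s => f s x) t

/-- Partial derivative in the second (space) variable. -/
noncomputable def px (f : ℝ → ℝ → ℝ) : ℝ → ℝ → ℝ := fun t x => deriv (fun y => f t y) x

open Set MeasureTheory Filter Topology

/-- Continuity together with polynomial decay for nonnegative times. -/
structure Bd (f : ℝ → ℝ → ℝ) (M m : ℝ) : Prop where
  cont : Continuous (Function.uncurry f)
  bound : ∀ t, 0 ≤ t → ∀ x, |f t x| ≤ M * (1 + t) ^ (-m)

/-- The second function is the continuous space derivative of the first, with decay for both. -/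
structure Good (f f' : ℝ → ℝ → ℝ) (M m : ℝ) : Prop where
  bd : Bd f M m
  bd' : Bd f' M m
  der : ∀ t x, HasDerivAt (fun y => f t y) (f' t x) x

/-- Tail integral in time. -/
noncomputable def K (f : ℝ → ℝ → ℝ) (t x : ℝ) : ℝ :=
  (∫ s in Ioi (0:ℝ), f s x) - ∫ s in (0:ℝ)..t, f s x

/-- Tail integral along characteristics of speed `σ`. -/
noncomputable def J (σ : ℝ) (f : ℝ → ℝ → ℝ) (t x : ℝ) : ℝ :=
  K (fun s c => f s (c + σ * s)) t (x - σ * t)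

lemma partial_hasFDeriv {u ut ux : ℝ → ℝ → ℝ}
    (hut : Continuous (Function.uncurry ut)) (hux : Continuous (Function.uncurry ux))
    (h1 : ∀ t x, HasDerivAt (fun s => u s x) (ut t x) t)
    (h2 : ∀ t x, HasDerivAt (fun y => u t y) (ux t x) x) (p : ℝ × ℝ) :
    HasFDerivAt (Function.uncurry u)
      (ut p.1 p.2 • ContinuousLinearMap.fst ℝ ℝ ℝ + ux p.1 p.2 • ContinuousLinearMap.snd ℝ ℝ ℝ) p := by
  have := (hasStrictFDerivAt_uncurry_coprod (𝕜 := ℝ) (u := p) (f := u)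
    (f₁ := fun t x => ContinuousLinearMap.toSpanSingleton ℝ (ut t x))
    (f₂ := fun t x => ContinuousLinearMap.toSpanSingleton ℝ (ux t x))
    (Eventually.of_forall fun v => (h1 v.1 v.2).hasFDerivAt)
    (Eventually.of_forall fun v => (h2 v.1 v.2).hasFDerivAt)
    (by
      have : Continuous fun q : ℝ × ℝ => ContinuousLinearMap.toSpanSingleton ℝ (ut q.1 q.2) :=
        (ContinuousLinearMap.toSpanSingletonCLE (𝕜 := ℝ) (E := ℝ)).continuous.comp hut
      exact this.continuousAt)
    (by
      have : Continuous fun q : ℝ × ℝ => ContinuousLinearMap.toSpanSingleton ℝ (ux q.1 q.2) :=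
        (ContinuousLinearMap.toSpanSingletonCLE (𝕜 := ℝ) (E := ℝ)).continuous.comp hux
      exact this.continuousAt)).hasFDerivAt
  refine HasFDerivAt.congr_fderiv (f := Function.uncurry u) this ?_
  change (ContinuousLinearMap.toSpanSingleton ℝ (ut p.1 p.2)).coprod
    (ContinuousLinearMap.toSpanSingleton ℝ (ux p.1 p.2)) = _
  ext <;> simp

lemma partial_contDiff {u ut ux : ℝ → ℝ → ℝ} (n : ℕ)
    (hut : ContDiff ℝ n (Function.uncurry ut)) (hux : ContDiff ℝ n (Function.uncurry ux))
    (h1 : ∀ t x, HasDerivAt (fun s => u s x) (ut t x) t)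
    (h2 : ∀ t x, HasDerivAt (fun y => u t y) (ux t x) x) :
    ContDiff ℝ (n + 1) (Function.uncurry u) := by
  have h := partial_hasFDeriv hut.continuous hux.continuous h1 h2
  rw [contDiff_succ_iff_fderiv]
  refine ⟨fun p => (h p).differentiableAt, by simp, ?_⟩
  have e : fderiv ℝ (Function.uncurry u) = fun p =>
      (Function.uncurry ut p • ContinuousLinearMap.fst ℝ ℝ ℝ
        + Function.uncurry ux p • ContinuousLinearMap.snd ℝ ℝ ℝ) := by
    funext p; exact (h p).fderiv
  rw [e]
  fun_prop

lemma cont_slice {f : ℝ → ℝ → ℝ} (hf : Continuous (Function.uncurry f)) (x : ℝ) :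
    Continuous fun s => f s x :=
  hf.comp (by fun_prop : Continuous fun s : ℝ => (s, x))

lemma weight_deriv {m : ℝ} (hm : 1 < m) {s : ℝ} (hs : 0 ≤ s) :
    HasDerivAt (fun s : ℝ => -((1 + s) ^ (-(m - 1)) / (m - 1))) ((1 + s) ^ (-m)) s := by
  have h := (((hasDerivAt_id s).const_add 1).rpow_const (p := -(m - 1))
    (Or.inl (by simp only [id]; linarith))).div_const (m - 1)
  refine HasDerivAt.congr_deriv (f := fun s : ℝ => -((1 + s) ^ (-(m - 1)) / (m - 1))) h.neg ?_
  have : m - 1 ≠ 0 := by linarith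
  simp only [id]
  rw [show -(m - 1) - 1 = -m by ring]
  field_simp

lemma weight_tendsto {m : ℝ} (hm : 1 < m) :
    Tendsto (fun s : ℝ => -((1 + s) ^ (-(m - 1)) / (m - 1))) atTop (𝓝 0) := by
  have := (tendsto_rpow_neg_atTop (y := m - 1) (by linarith)).comp
    (tendsto_atTop_add_const_left atTop (1:ℝ) tendsto_id)
  simpa using (this.div_const (m - 1)).neg

lemma integrable_weight {m : ℝ} (hm : 1 < m) {t : ℝ} (ht : 0 ≤ t) :
    IntegrableOn (fun s : ℝ => (1 + s) ^ (-m)) (Ioi t) :=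
  integrableOn_Ioi_deriv_of_nonneg' (fun s hs => weight_deriv hm (ht.trans hs))
    (fun s hs => Real.rpow_nonneg (by linarith [mem_Ioi.1 hs]) _) (weight_tendsto hm)

lemma integral_weight {m : ℝ} (hm : 1 < m) {t : ℝ} (ht : 0 ≤ t) :
    ∫ s in Ioi t, (1 + s) ^ (-m) = (1 + t) ^ (-(m - 1)) / (m - 1) := by
  rw [integral_Ioi_of_hasDerivAt_of_tendsto' (fun s hs => weight_deriv hm (ht.trans hs))
    (integrable_weight hm ht) (weight_tendsto hm)]
  ring

lemma Bd.integrable {f : ℝ → ℝ → ℝ} {M m : ℝ} (hf : Bd f M m) (hm : 1 < m) {t : ℝ} (ht : 0 ≤ t)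
    (x : ℝ) : IntegrableOn (fun s => f s x) (Ioi t) := by
  refine Integrable.mono' ((integrable_weight hm ht).const_mul M)
    (cont_slice hf.cont x).aestronglyMeasurable ?_
  refine (ae_restrict_iff' measurableSet_Ioi).2 (Eventually.of_forall fun s hs => ?_)
  exact hf.bound s (ht.trans (le_of_lt hs)) x

lemma Bd.K_eq {f : ℝ → ℝ → ℝ} {M m : ℝ} (hf : Bd f M m) (hm : 1 < m) {t : ℝ} (ht : 0 ≤ t)
    (x : ℝ) : K f t x = ∫ s in Ioi t, f s x := by
  have := intervalIntegral.integral_Ioi_sub_Ioi (hf.integrable hm le_rfl x) ht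
  unfold K
  rw [← this]; ring

lemma Bd.integral_abs_le {f : ℝ → ℝ → ℝ} {M m : ℝ} (hf : Bd f M m) (hm : 1 < m) {t : ℝ}
    (ht : 0 ≤ t) (x : ℝ) :
    ∫ s in Ioi t, |f s x| ≤ M / (m - 1) * (1 + t) ^ (-(m - 1)) := by
  calc ∫ s in Ioi t, |f s x| ≤ ∫ s in Ioi t, M * (1 + s) ^ (-m) := by
        refine setIntegral_mono_on (hf.integrable hm ht x).abs
          ((integrable_weight hm ht).const_mul M) measurableSet_Ioi fun s hs => ?_
        exact hf.bound s (ht.trans (le_of_lt hs)) x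
    _ = _ := by
        rw [integral_const_mul, integral_weight hm ht]; ring

lemma Bd.K_bound {f : ℝ → ℝ → ℝ} {M m : ℝ} (hf : Bd f M m) (hm : 1 < m) {t : ℝ} (ht : 0 ≤ t)
    (x : ℝ) : |K f t x| ≤ M / (m - 1) * (1 + t) ^ (-(m - 1)) := by
  rw [hf.K_eq hm ht]
  exact (abs_integral_le_integral_abs).trans (hf.integral_abs_le hm ht x)

lemma Bd.K_cont {f : ℝ → ℝ → ℝ} {M m : ℝ} (hf : Bd f M m) (hm : 1 < m) :
    Continuous (Function.uncurry (K f)) := by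
  have h1 : Continuous fun x => ∫ s in Ioi (0:ℝ), f s x := by
    refine continuous_of_dominated (bound := fun s => M * (1 + s) ^ (-m)) ?_ ?_ ?_ ?_
    · exact fun x => (cont_slice hf.cont x).aestronglyMeasurable
    · refine fun x => (ae_restrict_iff' measurableSet_Ioi).2 (Eventually.of_forall fun s hs => ?_)
      exact hf.bound s (le_of_lt hs) x
    · exact (integrable_weight hm le_rfl).const_mul M
    · exact Eventually.of_forall fun s => hf.cont.comp (by fun_prop : Continuous fun x : ℝ => (s, x))
  have h2 : Continuous fun p : ℝ × ℝ => ∫ s in (0:ℝ)..p.1, f s p.2 := by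
    refine intervalIntegral.continuous_parametric_intervalIntegral_of_continuous
      (f := fun p : ℝ × ℝ => fun s => f s p.2) ?_ continuous_fst
    exact hf.cont.comp (by fun_prop : Continuous fun q : (ℝ × ℝ) × ℝ => (q.2, q.1.2))
  exact (h1.comp continuous_snd).sub h2

lemma K_deriv_t {f : ℝ → ℝ → ℝ} (hf : Continuous (Function.uncurry f)) (t x : ℝ) :
    HasDerivAt (fun s => K f s x) (-f t x) t := by
  have := (intervalIntegral.integral_hasDerivAt_right
    ((cont_slice hf x).intervalIntegrable 0 t)
    ((cont_slice hf x).stronglyMeasurableAtFilter _ _) (cont_slice hf x).continuousAt)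
  simpa [K] using this.const_sub (∫ s in Ioi (0:ℝ), f s x)

lemma Good.K_deriv_x {f f' : ℝ → ℝ → ℝ} {M m : ℝ} (hf : Good f f' M m) (hm : 1 < m) (t x : ℝ) :
    HasDerivAt (fun y => K f t y) (K f' t x) x := by
  refine HasDerivAt.sub ?_ ?_
  · refine (hasDerivAt_integral_of_dominated_loc_of_deriv_le (F := fun y s => f s y)
      (F' := fun y s => f' s y) (s := univ) (bound := fun s => M * (1 + s) ^ (-m))
      univ_mem ?_ ?_ ?_ ?_ ?_ ?_).2
    · exact Eventually.of_forall fun y => (cont_slice hf.bd.cont y).aestronglyMeasurable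
    · exact hf.bd.integrable hm le_rfl x
    · exact (cont_slice hf.bd'.cont x).aestronglyMeasurable
    · refine (ae_restrict_iff' measurableSet_Ioi).2 (Eventually.of_forall fun s hs y _ => ?_)
      exact hf.bd'.bound s (le_of_lt hs) y
    · exact (integrable_weight hm le_rfl).const_mul M
    · exact Eventually.of_forall fun s y _ => hf.der s y
  · obtain ⟨C, hC⟩ := ((isCompact_uIcc (a := (0:ℝ)) (b := t)).prod
      (isCompact_Icc (a := x - 1) (b := x + 1))).exists_bound_of_continuousOn hf.bd'.cont.continuousOn
    refine (intervalIntegral.hasDerivAt_integral_of_dominated_loc_of_deriv_le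
      (F := fun y s => f s y) (F' := fun y s => f' s y) (s := Icc (x - 1) (x + 1))
      (bound := fun _ => C) (Icc_mem_nhds (by linarith) (by linarith)) ?_ ?_ ?_ ?_ ?_ ?_).2
    · exact Eventually.of_forall fun y => (cont_slice hf.bd.cont y).aestronglyMeasurable
    · exact (cont_slice hf.bd.cont x).intervalIntegrable _ _
    · exact (cont_slice hf.bd'.cont x).aestronglyMeasurable
    · exact Eventually.of_forall fun s hs y hy => hC (s, y) ⟨uIoc_subset_uIcc hs, hy⟩
    · simp
    · exact Eventually.of_forall fun s _ y _ => hf.der s y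

lemma Bd.shift {f : ℝ → ℝ → ℝ} {M m : ℝ} (hf : Bd f M m) (σ : ℝ) :
    Bd (fun s c => f s (c + σ * s)) M m :=
  ⟨hf.cont.comp (by fun_prop : Continuous fun q : ℝ × ℝ => (q.1, q.2 + σ * q.1)),
    fun t ht _ => hf.bound t ht _⟩

lemma Good.shift {f f' : ℝ → ℝ → ℝ} {M m : ℝ} (hf : Good f f' M m) (σ : ℝ) :
    Good (fun s c => f s (c + σ * s)) (fun s c => f' s (c + σ * s)) M m :=
  ⟨hf.bd.shift σ, hf.bd'.shift σ, fun t x => (hf.der t (x + σ * t)).comp_add_const x (σ * t)⟩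

lemma Bd.J {f : ℝ → ℝ → ℝ} {M m : ℝ} (hf : Bd f M m) (hm : 1 < m) (σ : ℝ) :
    Bd (J σ f) (M / (m - 1)) (m - 1) :=
  ⟨((hf.shift σ).K_cont hm).comp (by fun_prop : Continuous fun q : ℝ × ℝ => (q.1, q.2 - σ * q.1)),
    fun _ ht _ => (hf.shift σ).K_bound hm ht _⟩

lemma Good.J {f f' : ℝ → ℝ → ℝ} {M m : ℝ} (hf : Good f f' M m) (hm : 1 < m) (σ : ℝ) :
    Good (J σ f) (J σ f') (M / (m - 1)) (m - 1) :=
  ⟨hf.bd.J hm σ, hf.bd'.J hm σ, fun t x =>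
    ((hf.shift σ).K_deriv_x hm t (x - σ * t)).comp_sub_const x (σ * t)⟩

lemma Good.J_deriv_t {f f' : ℝ → ℝ → ℝ} {M m : ℝ} (hf : Good f f' M m) (hm : 1 < m) (σ t x : ℝ) :
    HasDerivAt (fun s => _root_.J σ f s x) (-f t x - σ * _root_.J σ f' t x) t := by
  have hs := hf.shift σ
  have h := partial_hasFDeriv (u := K (fun s c => f s (c + σ * s)))
    (ut := fun t c => - f t (c + σ * t)) hs.bd.cont.neg (hs.bd'.K_cont hm)
    (fun t x => K_deriv_t hs.bd.cont t x) (hs.K_deriv_x hm) (t, x - σ * t)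
  have hg : HasDerivAt (fun s : ℝ => (s, x - σ * s)) (1, -σ) t := by
    refine (hasDerivAt_id t).prodMk ?_
    simpa using ((hasDerivAt_id t).const_mul σ).const_sub x
  have := h.comp_hasDerivAt t hg
  refine HasDerivAt.congr_deriv (f := fun s => _root_.J σ f s x) this ?_
  simp [_root_.J]; ring

lemma Good.J_contDiff {f f' : ℝ → ℝ → ℝ} {M m : ℝ} (hf : Good f f' M m) (hm : 1 < m) (σ : ℝ) :
    ContDiff ℝ 1 (Function.uncurry (_root_.J σ f)) := by
  have hJ := hf.J hm σ
  have := partial_contDiff (u := _root_.J σ f) (ut := fun t x => -f t x - σ * _root_.J σ f' t x)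
    (ux := _root_.J σ f') 0 ?_ ?_ (hf.J_deriv_t hm σ) hJ.der
  · simpa using this
  · exact contDiff_zero.2 (hf.bd.cont.neg.sub (hJ.bd'.cont.const_smul σ))
  · exact contDiff_zero.2 hJ.bd'.cont

lemma J_eq {f : ℝ → ℝ → ℝ} {M m : ℝ} (hf : Bd f M m) (hm : 1 < m) {t : ℝ} (ht : 0 ≤ t)
    (σ x : ℝ) : J σ f t x = ∫ s in Ioi t, f s (x - σ * t + σ * s) :=
  (hf.shift σ).K_eq hm ht _

lemma J_hasSum {f : ℕ → ℝ → ℝ → ℝ} {F : ℝ → ℝ → ℝ} {M : ℕ → ℝ} {M' m : ℝ} (hm : 1 < m)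
    (hf : ∀ n, Bd (f n) (M n) m) (hM : Summable M) (hF : Bd F M' m)
    (hs : ∀ t, 0 ≤ t → ∀ x, HasSum (fun n => f n t x) (F t x)) (σ t : ℝ) (ht : 0 ≤ t) (x : ℝ) :
    HasSum (fun n => J σ (f n) t x) (J σ F t x) := by
  have e : J σ F t x = ∫ s in Ioi t, ∑' n, f n s (x - σ * t + σ * s) := by
    rw [J_eq hF hm ht]
    refine setIntegral_congr_fun measurableSet_Ioi fun s hs' => ?_
    exact ((hs s (ht.trans (le_of_lt hs')) _).tsum_eq).symm
  rw [e]
  simp_rw [fun n => J_eq (hf n) hm ht σ x]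
  refine hasSum_integral_of_summable_integral_norm
    (fun n => ((hf n).shift σ).integrable hm ht (x - σ * t)) ?_
  refine Summable.of_nonneg_of_le (fun n => integral_nonneg fun _ => norm_nonneg _)
    (fun n => ((hf n).shift σ).integral_abs_le hm ht (x - σ * t)) ?_
  exact (hM.div_const _).mul_right _

lemma K_of_deriv {q p' : ℝ → ℝ → ℝ} {M M' m m' : ℝ} (hm : 1 < m) (hm' : 0 < m') (hp : Bd p' M m)
    (hq : Bd q M' m') (hd : ∀ t x, HasDerivAt (fun s => q s x) (p' t x) t) (t x : ℝ) :
    K p' t x = - q t x := by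
  have h0 : Tendsto (fun s => q s x) atTop (𝓝 0) := by
    have hw : Tendsto (fun s : ℝ => M' * (1 + s) ^ (-m')) atTop (𝓝 0) := by
      have := (tendsto_rpow_neg_atTop hm').comp (tendsto_atTop_add_const_left atTop (1:ℝ) tendsto_id)
      simpa using this.const_mul M'
    refine squeeze_zero_norm' ?_ hw
    filter_upwards [eventually_ge_atTop 0] with s hs using hq.bound s hs x
  have h1 := integral_Ioi_of_hasDerivAt_of_tendsto' (a := (0:ℝ)) (fun s _ => hd s x)
    (hp.integrable hm le_rfl x) h0
  have h2 := intervalIntegral.integral_eq_sub_of_hasDerivAt (a := (0:ℝ)) (b := t)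
    (fun s _ => hd s x) ((cont_slice hp.cont x).intervalIntegrable _ _)
  unfold K
  rw [h1, h2]; ring

/-- The time derivative of the solution of the wave equation with source `f`. -/
noncomputable def P (f : ℝ → ℝ → ℝ) (t x : ℝ) : ℝ := -(J 1 f t x + J (-1) f t x) / 2

/-- The space derivative of the solution of the wave equation with source `f`. -/
noncomputable def Q (f : ℝ → ℝ → ℝ) (t x : ℝ) : ℝ := (J 1 f t x - J (-1) f t x) / 2

/-- The solution, vanishing at infinity, of the wave equation with source `f`. -/
noncomputable def H (f : ℝ → ℝ → ℝ) (t x : ℝ) : ℝ := -J 0 (P f) t x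

lemma abs_half_add {u v b : ℝ} (hu : |u| ≤ b) (hv : |v| ≤ b) : |-(u + v) / 2| ≤ b := by
  rw [abs_le] at *; constructor <;> linarith [hu.1, hu.2, hv.1, hv.2]

lemma abs_half_sub {u v b : ℝ} (hu : |u| ≤ b) (hv : |v| ≤ b) : |(u - v) / 2| ≤ b := by
  rw [abs_le] at *; constructor <;> linarith [hu.1, hu.2, hv.1, hv.2]

lemma Bd.P {f : ℝ → ℝ → ℝ} {M m : ℝ} (hf : Bd f M m) (hm : 1 < m) :
    Bd (P f) (M / (m - 1)) (m - 1) :=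
  ⟨((hf.J hm 1).cont.add (hf.J hm (-1)).cont).neg.div_const 2,
    fun t ht x => abs_half_add ((hf.J hm 1).bound t ht x) ((hf.J hm (-1)).bound t ht x)⟩

lemma Bd.Q {f : ℝ → ℝ → ℝ} {M m : ℝ} (hf : Bd f M m) (hm : 1 < m) :
    Bd (Q f) (M / (m - 1)) (m - 1) :=
  ⟨((hf.J hm 1).cont.sub (hf.J hm (-1)).cont).div_const 2,
    fun t ht x => abs_half_sub ((hf.J hm 1).bound t ht x) ((hf.J hm (-1)).bound t ht x)⟩

lemma Good.P {f f' : ℝ → ℝ → ℝ} {M m : ℝ} (hf : Good f f' M m) (hm : 1 < m) :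
    Good (P f) (P f') (M / (m - 1)) (m - 1) :=
  ⟨hf.bd.P hm, hf.bd'.P hm, fun t x =>
    (((hf.J hm 1).der t x).add ((hf.J hm (-1)).der t x)).neg.div_const 2⟩

lemma Good.Q {f f' : ℝ → ℝ → ℝ} {M m : ℝ} (hf : Good f f' M m) (hm : 1 < m) :
    Good (Q f) (Q f') (M / (m - 1)) (m - 1) :=
  ⟨hf.bd.Q hm, hf.bd'.Q hm, fun t x =>
    (((hf.J hm 1).der t x).sub ((hf.J hm (-1)).der t x)).div_const 2⟩

lemma Good.neg {f f' : ℝ → ℝ → ℝ} {M m : ℝ} (hf : Good f f' M m) :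
    Good (fun t x => -f t x) (fun t x => -f' t x) M m :=
  ⟨⟨hf.bd.cont.neg, fun t ht x => by rw [abs_neg]; exact hf.bd.bound t ht x⟩,
    ⟨hf.bd'.cont.neg, fun t ht x => by rw [abs_neg]; exact hf.bd'.bound t ht x⟩,
    fun t x => (hf.der t x).neg⟩

lemma Good.H {f f' : ℝ → ℝ → ℝ} {M m : ℝ} (hf : Good f f' M m) (hm : 2 < m) :
    Good (H f) (H f') (M / (m - 1) / (m - 1 - 1)) (m - 1 - 1) :=
  ((hf.P (by linarith)).J (by linarith) 0).neg

lemma Bd.clamp {f : ℝ → ℝ → ℝ} {M m : ℝ} (hf : Bd f M m) : Bd (fun t x => f (max t 0) x) M m :=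
  ⟨hf.cont.comp (by fun_prop : Continuous fun q : ℝ × ℝ => (max q.1 0, q.2)),
    fun t ht x => by simpa [max_eq_left ht] using hf.bound t ht x⟩

lemma Good.clamp {f f' : ℝ → ℝ → ℝ} {M m : ℝ} (hf : Good f f' M m) :
    Good (fun t x => f (max t 0) x) (fun t x => f' (max t 0) x) M m :=
  ⟨hf.bd.clamp, hf.bd'.clamp, fun t x => hf.der (max t 0) x⟩

lemma Bd.weaken {f : ℝ → ℝ → ℝ} {M m n : ℝ} (hf : Bd f M m) (hM : 0 ≤ M) (h : n ≤ m) :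
    Bd f M n :=
  ⟨hf.cont, fun t ht x => (hf.bound t ht x).trans (mul_le_mul_of_nonneg_left
    (Real.rpow_le_rpow_of_exponent_le (by linarith) (by linarith)) hM)⟩

lemma Good.weaken {f f' : ℝ → ℝ → ℝ} {M m n : ℝ} (hf : Good f f' M m) (hM : 0 ≤ M) (h : n ≤ m) :
    Good f f' M n := ⟨hf.bd.weaken hM h, hf.bd'.weaken hM h, hf.der⟩

lemma Bd.add {f g : ℝ → ℝ → ℝ} {M N m : ℝ} (hf : Bd f M m) (hg : Bd g N m) :
    Bd (fun t x => f t x + g t x) (M + N) m :=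
  ⟨hf.cont.add hg.cont, fun t ht x => (abs_add_le _ _).trans (by
    rw [add_mul]; exact add_le_add (hf.bound t ht x) (hg.bound t ht x))⟩

lemma Good.add {f f' g g' : ℝ → ℝ → ℝ} {M N m : ℝ} (hf : Good f f' M m) (hg : Good g g' N m) :
    Good (fun t x => f t x + g t x) (fun t x => f' t x + g' t x) (M + N) m :=
  ⟨hf.bd.add hg.bd, hf.bd'.add hg.bd', fun t x => (hf.der t x).add (hg.der t x)⟩

lemma Bd.mul {f g : ℝ → ℝ → ℝ} {M N m n : ℝ} (hf : Bd f M m) (hg : Bd g N n) :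
    Bd (fun t x => f t x * g t x) (M * N) (m + n) :=
  ⟨hf.cont.mul hg.cont, fun t ht x => by
    rw [abs_mul, neg_add, Real.rpow_add (by linarith)]
    calc |f t x| * |g t x| ≤ (M * (1 + t) ^ (-m)) * (N * (1 + t) ^ (-n)) :=
          mul_le_mul (hf.bound t ht x) (hg.bound t ht x) (abs_nonneg _)
            ((abs_nonneg _).trans (hf.bound t ht x))
      _ = _ := by ring⟩

lemma Bd.mono {f : ℝ → ℝ → ℝ} {M N m : ℝ} (hf : Bd f M m) (h : M ≤ N) : Bd f N m :=
  ⟨hf.cont, fun t ht x => (hf.bound t ht x).trans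
    (mul_le_mul_of_nonneg_right h (Real.rpow_nonneg (by linarith) _))⟩

lemma Good.mono {f f' : ℝ → ℝ → ℝ} {M N m : ℝ} (hf : Good f f' M m) (h : M ≤ N) :
    Good f f' N m := ⟨hf.bd.mono h, hf.bd'.mono h, hf.der⟩

lemma Good.mul {f f' g g' : ℝ → ℝ → ℝ} {M N m n : ℝ} (hf : Good f f' M m) (hg : Good g g' N n)
    (hM : 0 ≤ M) (hN : 0 ≤ N) :
    Good (fun t x => f t x * g t x) (fun t x => f' t x * g t x + f t x * g' t x)
      (2 * (M * N)) (m + n) :=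
  ⟨(hf.bd.mul hg.bd).mono (by nlinarith [mul_nonneg hM hN]),
    ((hf.bd'.mul hg.bd).add (hf.bd.mul hg.bd')).mono (by linarith),
    fun t x => (hf.der t x).mul (hg.der t x)⟩

/-- The iterates of the Neumann series, together with their space derivatives. -/
noncomputable def iter (b b' c c' : ℝ → ℝ → ℝ) : ℕ → (ℝ → ℝ → ℝ) × (ℝ → ℝ → ℝ)
  | 0 => (fun t x => c (max t 0) x, fun t x => c' (max t 0) x)
  | n + 1 =>
    (fun t x => c (max t 0) x * H (iter b b' c c' n).1 (max t 0) x
        + b (max t 0) x * P (iter b b' c c' n).1 (max t 0) x,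
     fun t x => (c' (max t 0) x * H (iter b b' c c' n).1 (max t 0) x
        + c (max t 0) x * H (iter b b' c c' n).2 (max t 0) x)
        + (b' (max t 0) x * P (iter b b' c c' n).1 (max t 0) x
        + b (max t 0) x * P (iter b b' c c' n).2 (max t 0) x))

lemma iter_clamp (b b' c c' : ℝ → ℝ → ℝ) (n : ℕ) (t x : ℝ) :
    (iter b b' c c' n).1 t x = (iter b b' c c' n).1 (max t 0) x ∧
    (iter b b' c c' n).2 t x = (iter b b' c c' n).2 (max t 0) x := by
  cases n <;> simp [iter]

lemma iter_good {b b' c c' : ℝ → ℝ → ℝ} {δ k : ℝ} (hk : 1 < k) (hδ : 0 < δ)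
    (hb : Good b b' δ k) (hc : Good c c' δ (k + 1)) (n : ℕ) :
    Good (iter b b' c c' n).1 (iter b b' c c' n).2 (δ * (2 * δ / (k - 1)) ^ n) (k + 1) := by
  have hk' : 0 < k - 1 := by linarith
  induction n with
  | zero => simpa [iter] using hc.clamp
  | succ n ih =>
    set M := δ * (2 * δ / (k - 1)) ^ n with hM
    have hM0 : 0 ≤ M := by positivity
    have hP := ih.P (by linarith)
    have hH := ih.H (by linarith)
    rw [show k + 1 - 1 = k by ring] at hP hH
    have h1 := ((hc.mul hH hδ.le (by positivity)).clamp.weaken (by positivity)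
      (by linarith : k + 1 ≤ _)).add
      ((hb.mul hP hδ.le (by positivity)).clamp.weaken (by positivity) (by linarith : k + 1 ≤ _))
    refine Good.mono (f := (iter b b' c c' (n+1)).1) (f' := (iter b b' c c' (n+1)).2) h1 (le_of_eq ?_)
    rw [show δ * (2 * δ / (k - 1)) ^ (n + 1) = M * (2 * δ / (k - 1)) by rw [hM]; ring]
    have : k ≠ 0 := by linarith
    field_simp
    ring

lemma H_hasSum {f : ℕ → ℝ → ℝ → ℝ} {F : ℝ → ℝ → ℝ} {M : ℕ → ℝ} {M' m : ℝ} (hm : 2 < m)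
    (hf : ∀ n, Bd (f n) (M n) m) (hM : Summable M) (hF : Bd F M' m)
    (hs : ∀ t, 0 ≤ t → ∀ x, HasSum (fun n => f n t x) (F t x)) (t : ℝ) (ht : 0 ≤ t) (x : ℝ) :
    HasSum (fun n => P (f n) t x) (P F t x) ∧ HasSum (fun n => H (f n) t x) (H F t x) := by
  have hp : ∀ t, 0 ≤ t → ∀ x, HasSum (fun n => P (f n) t x) (P F t x) := fun t ht x =>
    ((J_hasSum (by linarith) hf hM hF hs 1 t ht x).add
      (J_hasSum (by linarith) hf hM hF hs (-1) t ht x)).neg.div_const 2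
  exact ⟨hp t ht x, (J_hasSum (by linarith) (fun n => (hf n).P (by linarith)) (hM.div_const _)
    (hF.P (by linarith)) hp 0 t ht x).neg⟩

lemma exists_source {b b' c c' : ℝ → ℝ → ℝ} {δ k : ℝ} (hk : 1 < k) (hδ : 0 < δ)
    (hb : Good b b' δ k) (hc : Good c c' δ (k + 1)) (hr : 2 * δ / (k - 1) ≤ 1 / 2) :
    ∃ f f', Good f f' (2 * δ) (k + 1) ∧ ∀ t, 0 ≤ t → ∀ x,
      f t x = c t x * (1 + H f t x) + b t x * P f t x := by
  have hk' : 0 < k - 1 := by linarith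
  set r := 2 * δ / (k - 1) with hrdef
  have hr0 : 0 ≤ r := by positivity
  set s := iter b b' c c' with hsdef
  have hg : ∀ n, Good (s n).1 (s n).2 (δ * r ^ n) (k + 1) := fun n => iter_good hk hδ hb hc n
  have hsum : HasSum (fun n : ℕ => δ * r ^ n) (δ * (1 - r)⁻¹) :=
    (hasSum_geometric_of_lt_one hr0 (by linarith)).mul_left δ
  have hle : δ * (1 - r)⁻¹ ≤ 2 * δ := by
    have : (1 - r)⁻¹ ≤ 2 := by
      rw [inv_le_comm₀ (by linarith) (by norm_num)]; linarith
    nlinarith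
  have hw : ∀ n (t : ℝ), δ * r ^ n * (1 + max t 0) ^ (-(k + 1)) ≤ δ * r ^ n := fun n t => by
    refine mul_le_of_le_one_right (by positivity) ?_
    exact Real.rpow_le_one_of_one_le_of_nonpos (by linarith [le_max_right t 0]) (by linarith)
  have hb1 : ∀ n t x, ‖(s n).1 t x‖ ≤ δ * r ^ n := fun n t x => by
    rw [(iter_clamp b b' c c' n t x).1]
    exact ((hg n).bd.bound _ (le_max_right _ _) x).trans (hw n t)
  have hb2 : ∀ n t x, ‖(s n).2 t x‖ ≤ δ * r ^ n := fun n t x => by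
    rw [(iter_clamp b b' c c' n t x).2]
    exact ((hg n).bd'.bound _ (le_max_right _ _) x).trans (hw n t)
  have hs1 : ∀ t x, Summable fun n => (s n).1 t x := fun t x =>
    Summable.of_norm_bounded hsum.summable fun n => hb1 n t x
  set F : ℝ → ℝ → ℝ := fun t x => ∑' n, (s n).1 t x with hF
  set F' : ℝ → ℝ → ℝ := fun t x => ∑' n, (s n).2 t x with hF'
  have hGF : Good F F' (2 * δ) (k + 1) := by
    refine ⟨⟨continuous_tsum (fun n => (hg n).bd.cont) hsum.summable fun n p => hb1 n p.1 p.2, ?_⟩,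
      ⟨continuous_tsum (fun n => (hg n).bd'.cont) hsum.summable fun n p => hb2 n p.1 p.2, ?_⟩, ?_⟩
    · intro t ht x
      exact (tsum_of_norm_bounded (f := fun n => (s n).1 t x) (hsum.mul_right ((1 + t) ^ (-(k + 1))))
        fun n => (hg n).bd.bound t ht x).trans
        (mul_le_mul_of_nonneg_right hle (Real.rpow_nonneg (by linarith) _))
    · intro t ht x
      exact (tsum_of_norm_bounded (f := fun n => (s n).2 t x) (hsum.mul_right ((1 + t) ^ (-(k + 1))))
        fun n => (hg n).bd'.bound t ht x).trans
        (mul_le_mul_of_nonneg_right hle (Real.rpow_nonneg (by linarith) _))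
    · intro t x
      exact hasDerivAt_tsum hsum.summable (fun n y => (hg n).der t y) (fun n y => hb2 n t y)
        (hs1 t x) x
  refine ⟨F, F', hGF, fun t ht x => ?_⟩
  have hPH := H_hasSum (by linarith) (fun n => (hg n).bd) hsum.summable hGF.bd
    (fun t _ x => (hs1 t x).hasSum) t ht x
  have h1 : HasSum (fun n => (s (n + 1)).1 t x) (c t x * H F t x + b t x * P F t x) := by
    have := (hPH.2.mul_left (c t x)).add (hPH.1.mul_left (b t x))
    simpa [hsdef, iter, max_eq_left ht] using this
  have h2 := (hs1 t x).tsum_eq_zero_add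
  have h0 : (s 0).1 t x = c t x := by simp [hsdef, iter, max_eq_left ht]
  rw [h1.tsum_eq, h0] at h2
  change ∑' n, (s n).1 t x = _
  rw [h2]; ring

lemma solution {f f' : ℝ → ℝ → ℝ} {M k : ℝ} (hk : 1 < k) (hf : Good f f' M (k + 1)) :
    ContDiff ℝ 2 (Function.uncurry (H f)) ∧ pt (H f) = P f ∧ px (H f) = Q f ∧
    ∀ t x, pt (P f) t x - px (Q f) t x = f t x := by
  have hk1 : 1 < k + 1 := by linarith
  have hP := hf.P hk1
  have hQ := hf.Q hk1
  have hPt : ∀ t x, HasDerivAt (fun s => P f s x) (f t x + Q f' t x) t := fun t x => by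
    have := ((hf.J_deriv_t hk1 1 t x).add (hf.J_deriv_t hk1 (-1) t x)).neg.div_const 2
    refine HasDerivAt.congr_deriv (f := fun s => P f s x) this ?_
    simp only [Q]; ring
  have hQt : ∀ t x, HasDerivAt (fun s => Q f s x) (P f' t x) t := fun t x => by
    have := ((hf.J_deriv_t hk1 1 t x).sub (hf.J_deriv_t hk1 (-1) t x)).div_const 2
    refine HasDerivAt.congr_deriv (f := fun s => Q f s x) this ?_
    simp only [P]; ring
  have hHt : ∀ t x, HasDerivAt (fun s => H f s x) (P f t x) t := fun t x => by
    have := (hP.J_deriv_t (by linarith) 0 t x).neg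
    refine HasDerivAt.congr_deriv (f := fun s => H f s x) this ?_
    ring
  have hHx : ∀ t x, HasDerivAt (fun y => H f t y) (Q f t x) x := fun t x => by
    have := (hf.H (by linarith)).der t x
    refine HasDerivAt.congr_deriv this ?_
    have hK := K_of_deriv (by linarith) (by linarith) hP.bd' hQ.bd hQt t x
    simp only [H, J]
    simp [hK]
  have hPc : ContDiff ℝ 1 (Function.uncurry (P f)) :=
    ((hf.J_contDiff hk1 1).add (hf.J_contDiff hk1 (-1))).neg.div_const 2
  have hQc : ContDiff ℝ 1 (Function.uncurry (Q f)) :=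
    ((hf.J_contDiff hk1 1).sub (hf.J_contDiff hk1 (-1))).div_const 2
  refine ⟨?_, ?_, ?_, ?_⟩
  · have := partial_contDiff 1 (by exact_mod_cast hPc) (by exact_mod_cast hQc) hHt hHx
    norm_num at this
    exact this
  · funext t x; exact (hHt t x).deriv
  · funext t x; exact (hHx t x).deriv
  · intro t x
    have h1 : pt (P f) t x = f t x + Q f' t x := (hPt t x).deriv
    have h2 : px (Q f) t x = Q f' t x := (hQ.der t x).deriv
    rw [h1, h2]; ring

lemma pt_eq {a : ℝ → ℝ → ℝ} (ha : Differentiable ℝ (Function.uncurry a)) (t x : ℝ) :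
    HasDerivAt (fun s => a s x) (fderiv ℝ (Function.uncurry a) (t, x) (1, 0)) t := by
  have hg : HasDerivAt (fun s : ℝ => (s, x)) (1, 0) t :=
    (hasDerivAt_id t).prodMk (hasDerivAt_const t x)
  exact (ha (t, x)).hasFDerivAt.comp_hasDerivAt t hg

lemma px_eq {a : ℝ → ℝ → ℝ} (ha : Differentiable ℝ (Function.uncurry a)) (t x : ℝ) :
    HasDerivAt (fun y => a t y) (fderiv ℝ (Function.uncurry a) (t, x) (0, 1)) x := by
  have hg : HasDerivAt (fun y : ℝ => (t, y)) (0, 1) x :=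
    (hasDerivAt_const x t).prodMk (hasDerivAt_id x)
  exact (ha (t, x)).hasFDerivAt.comp_hasDerivAt x hg

lemma coeff_facts {a : ℝ → ℝ → ℝ} (ha : ContDiff ℝ 2 (Function.uncurry a)) :
    Continuous (Function.uncurry (px a)) ∧ Continuous (Function.uncurry (pt a)) ∧
    Continuous (Function.uncurry (pt (px a))) ∧
    (∀ t x, HasDerivAt (fun y => a t y) (px a t x) x) ∧
    (∀ t x, HasDerivAt (fun y => pt a t y) (pt (px a) t x) x) := by
  have hd : Differentiable ℝ (Function.uncurry a) := ha.differentiable (by norm_num)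
  have hfd : ContDiff ℝ 1 (fderiv ℝ (Function.uncurry a)) := ha.fderiv_right (by norm_num)
  have hfdd : Differentiable ℝ (fderiv ℝ (Function.uncurry a)) := hfd.differentiable (by norm_num)
  have et : pt a = fun t x => fderiv ℝ (Function.uncurry a) (t, x) (1, 0) := by
    funext t x; exact (pt_eq hd t x).deriv
  have ex : px a = fun t x => fderiv ℝ (Function.uncurry a) (t, x) (0, 1) := by
    funext t x; exact (px_eq hd t x).deriv
  have ct : ContDiff ℝ 1 (Function.uncurry (pt a)) := by
    rw [et]; exact hfd.clm_apply contDiff_const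
  have cx : ContDiff ℝ 1 (Function.uncurry (px a)) := by
    rw [ex]; exact hfd.clm_apply contDiff_const
  have dt := ct.differentiable (by norm_num)
  have dx := cx.differentiable (by norm_num)
  have etx : pt (px a) = fun t x => fderiv ℝ (Function.uncurry (px a)) (t, x) (1, 0) := by
    funext t x; exact (pt_eq dx t x).deriv
  refine ⟨cx.continuous, ct.continuous, ?_, ?_, ?_⟩
  · rw [etx]
    exact (cx.continuous_fderiv (by norm_num)).clm_apply continuous_const
  · intro t x; rw [ex]; exact px_eq hd t x
  · intro t x
    refine (px_eq dt t x).congr_deriv ?_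
    rw [etx]
    have e1 : fderiv ℝ (Function.uncurry (pt a)) (t, x) (0, 1)
        = fderiv ℝ (fderiv ℝ (Function.uncurry a)) (t, x) (0, 1) (1, 0) := by
      rw [et]
      have := (hfdd (t, x)).hasFDerivAt.clm_apply (hasFDerivAt_const ((1:ℝ), (0:ℝ)) (t, x))
      have h2 := this.fderiv
      change fderiv ℝ (fun p => fderiv ℝ (Function.uncurry a) p (1, 0)) (t, x) (0, 1) = _
      rw [h2]; simp
    have e2 : fderiv ℝ (Function.uncurry (px a)) (t, x) (1, 0)
        = fderiv ℝ (fderiv ℝ (Function.uncurry a)) (t, x) (1, 0) (0, 1) := by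
      rw [ex]
      have := (hfdd (t, x)).hasFDerivAt.clm_apply (hasFDerivAt_const ((0:ℝ), (1:ℝ)) (t, x))
      have h2 := this.fderiv
      change fderiv ℝ (fun p => fderiv ℝ (Function.uncurry a) p (0, 1)) (t, x) (1, 0) = _
      rw [h2]; simp
    beta_reduce
    rw [e1, e2]
    exact (ha.contDiffAt.isSymmSndFDerivAt (by simp)) _ _

theorem stmt6 (θ k : ℝ) (hθ : θ ∈ Set.Ioo (0:ℝ) 1) (hk : 1 < k) :
    ∃ δ₀ > 0, ∀ δ ∈ Set.Ioo 0 δ₀, ∀ a : ℝ → ℝ → ℝ,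
      ContDiff ℝ 2 (Function.uncurry a) →
      (∀ t, 0 ≤ t → ∀ x,
        |a t x| ≤ δ / (1 + t) ^ k ∧
        |px a t x| ≤ δ / (1 + t) ^ k ∧
        |pt a t x| ≤ δ / (1 + t) ^ (k + 1) ∧
        |pt (px a) t x| ≤ δ / (1 + t) ^ (k + 1)) →
      ∃ h : ℝ → ℝ → ℝ, ContDiff ℝ 2 (Function.uncurry h) ∧
        (∀ t, 0 ≤ t → ∀ x,
          pt (pt h) t x - px (px h) t x - a t x * pt h t x
            - pt a t x * (1 + h t x) = 0) ∧
        (∀ t, 0 ≤ t → ∀ x, |h t x| ≤ θ * (1 + t) ^ (-(k - 1))) ∧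
        ∃ C > 0, ∀ t, 0 ≤ t → ∀ x,
          |pt h t x| ≤ C * (1 + t) ^ (-k) ∧ |px h t x| ≤ C * (1 + t) ^ (-k) := by
  have hk' : 0 < k - 1 := by linarith
  obtain ⟨hθ0, hθ1⟩ := hθ
  refine ⟨θ * (k - 1) / 4, by positivity, ?_⟩
  rintro δ ⟨hδ, hδ'⟩ a ha hbd
  obtain ⟨c1, c2, c3, d1, d2⟩ := coeff_facts ha
  have conv : ∀ {y t m : ℝ}, 0 ≤ t → y ≤ δ / (1 + t) ^ m → y ≤ δ * (1 + t) ^ (-m) := by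
    intro y t m ht h
    rwa [Real.rpow_neg (by linarith), ← div_eq_mul_inv]
  have hb : Good a (px a) δ k :=
    ⟨⟨ha.continuous, fun t ht x => conv ht (hbd t ht x).1⟩,
      ⟨c1, fun t ht x => conv ht (hbd t ht x).2.1⟩, d1⟩
  have hc : Good (pt a) (pt (px a)) δ (k + 1) :=
    ⟨⟨c2, fun t ht x => conv ht (hbd t ht x).2.2.1⟩,
      ⟨c3, fun t ht x => conv ht (hbd t ht x).2.2.2⟩, d2⟩
  have hr : 2 * δ / (k - 1) ≤ θ / 2 := by
    rw [div_le_iff₀ hk']; linarith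
  obtain ⟨f, f', hf, hfe⟩ := exists_source hk hδ hb hc (by linarith)
  obtain ⟨s1, s2, s3, s4⟩ := solution hk hf
  have hH := (hf.H (by linarith)).bd
  have hP := (hf.P (by linarith)).bd
  have hQ := (hf.Q (by linarith)).bd
  rw [show k + 1 - 1 = k by ring] at hH hP hQ
  refine ⟨H f, s1, ?_, ?_, 2 * δ / k, by positivity, ?_⟩
  · intro t ht x
    rw [s2, s3, s4, hfe t ht x]; ring
  · refine (hH.mono ?_).bound
    have : 2 * δ / k / (k - 1) = 2 * δ / (k - 1) / k := by ring
    rw [this, div_le_iff₀ (by linarith)]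
    nlinarith
  · intro t ht x
    rw [s2, s3]
    exact ⟨hP.bound t ht x, hQ.bound t ht x⟩
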